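/- arXiv:math/0602135 — 2 statements merged into one kernel-verified Lean document; each statement's English description precedes it below -/
import Mathlib

section
/- Let f = e^ψ be a continuous positive density on ℝ with ψ concave (f is log-concave) and with finite total measure ∫_ℝ f < ∞. Then for every V ∈ (0, ∫_ℝ f) some half-line of weighted volume V (an interval of the form (−∞, x) or (x, +∞)) is an isoperimetric region of volume V. If moreover ψ is strictly concave, then every isoperimetric region of volume V is a half-line. -/
open Filter MeasureTheory Set

/-- Weighted volume of a set `Ω ⊆ ℝ` with respect to the density `f`. -/
noncomputable def wvol (f : ℝ → ℝ) (Ω : Set ℝ) : ENNReal :=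
  ∫⁻ x in Ω, ENNReal.ofReal (f x)

/-- Weighted perimeter of a set `Ω ⊆ ℝ`: the sum of `f` over the topological
boundary of `Ω`. -/
noncomputable def wper (f : ℝ → ℝ) (Ω : Set ℝ) : ENNReal :=
  ∑' x : frontier Ω, ENNReal.ofReal (f x)

/-- `Ω` is an isoperimetric region (minimizer) of weighted volume `V` on the line. -/
def IsIsopRegion (f : ℝ → ℝ) (Ω : Set ℝ) (V : ENNReal) : Prop :=
  IsOpen Ω ∧ wvol f Ω = V ∧
    ∀ U : Set ℝ, IsOpen U → wvol f U = V → wper f Ω ≤ wper f U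


theorem aux_conc (ψ : ℝ → ℝ) (h : ConcaveOn ℝ univ ψ) (d t p : ℝ) (hd : 0 < d) (ht : t ≤ p) :
    ψ (t - d) + ψ p ≤ ψ t + ψ (p - d) := by
  have hL : 0 < p - t + d := by linarith
  have w1 : 0 ≤ (p - t) / (p - t + d) := div_nonneg (by linarith) hL.le
  have w2 : 0 ≤ d / (p - t + d) := by positivity
  have w3 : (p - t) / (p - t + d) + d / (p - t + d) = 1 := by field_simp
  have H1 := h.2 (mem_univ (t - d)) (mem_univ p) w1 w2 w3
  have H2 := h.2 (mem_univ (t - d)) (mem_univ p) w2 w1 (by rw [add_comm]; exact w3)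
  simp only [smul_eq_mul] at H1 H2
  have e1 : (p - t) / (p - t + d) * (t - d) + d / (p - t + d) * p = t := by
    field_simp; ring
  have e2 : d / (p - t + d) * (t - d) + (p - t) / (p - t + d) * p = p - d := by
    field_simp; ring
  have e3 : (p - t) / (p - t + d) + d / (p - t + d) = 1 := by field_simp
  rw [e1] at H1
  rw [e2] at H2
  have : (p - t) / (p - t + d) = 1 - d / (p - t + d) := by linarith
  rw [this] at H1 H2
  linarith

theorem aux_sconc (ψ : ℝ → ℝ) (h : StrictConcaveOn ℝ univ ψ) (d t p : ℝ) (hd : 0 < d)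
    (ht : t < p) : ψ (t - d) + ψ p < ψ t + ψ (p - d) := by
  have hL : 0 < p - t + d := by linarith
  have hne : t - d ≠ p := by intro h; linarith
  have w1 : 0 < (p - t) / (p - t + d) := div_pos (by linarith) hL
  have w2 : 0 < d / (p - t + d) := by positivity
  have w3 : (p - t) / (p - t + d) + d / (p - t + d) = 1 := by field_simp
  have H1 := h.2 (mem_univ (t - d)) (mem_univ p) hne w1 w2 w3
  have H2 := h.2 (mem_univ (t - d)) (mem_univ p) hne w2 w1 (by rw [add_comm]; exact w3)
  simp only [smul_eq_mul] at H1 H2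
  have e1 : (p - t) / (p - t + d) * (t - d) + d / (p - t + d) * p = t := by
    field_simp; ring
  have e2 : d / (p - t + d) * (t - d) + (p - t) / (p - t + d) * p = p - d := by
    field_simp; ring
  have e3 : (p - t) / (p - t + d) + d / (p - t + d) = 1 := by field_simp
  rw [e1] at H1
  rw [e2] at H2
  have : (p - t) / (p - t + d) = 1 - d / (p - t + d) := by linarith
  rw [this] at H1 H2
  linarith

theorem aux_shift (f : ℝ → ℝ) (p d : ℝ) :
    ∫ t in Iic (p - d), f t = ∫ t in Iic p, f (t - d) := by
  have := (measurePreserving_sub_right volume d).setIntegral_preimage_emb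
    (MeasurableEquiv.subRight d).measurableEmbedding f (Iic (p - d))
  rw [← this]
  congr 2
  ext t; simp

theorem aux_ratio (ψ f : ℝ → ℝ) (hf : ∀ x : ℝ, f x = Real.exp (ψ x))
    (h : ConcaveOn ℝ univ ψ) (hint : Integrable f) (x p : ℝ) (hxp : x < p) :
    (∫ t in Iic x, f t) * f p ≤ (∫ t in Iic p, f t) * f x := by
  obtain ⟨d, hd, rfl⟩ : ∃ d, 0 < d ∧ x = p - d := ⟨p - x, by linarith, by ring⟩
  rw [aux_shift, ← integral_mul_const, ← integral_mul_const]
  refine setIntegral_mono_on ((hint.comp_sub_right d).mul_const _).integrableOn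
    (hint.mul_const _).integrableOn measurableSet_Iic ?_
  intro t ht
  simp only [hf, ← Real.exp_add]
  exact Real.exp_le_exp.2 (aux_conc ψ h d t p hd ht)

theorem aux_ratio_strict (ψ f : ℝ → ℝ) (hf : ∀ x : ℝ, f x = Real.exp (ψ x))
    (h : StrictConcaveOn ℝ univ ψ) (hint : Integrable f) (x p : ℝ) (hxp : x < p) :
    (∫ t in Iic x, f t) * f p < (∫ t in Iic p, f t) * f x := by
  obtain ⟨d, hd, rfl⟩ : ∃ d, 0 < d ∧ x = p - d := ⟨p - x, by linarith, by ring⟩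
  rw [aux_shift, ← integral_mul_const, ← integral_mul_const, ← sub_pos,
    ← integral_sub (hint.mul_const _).integrableOn
      ((hint.comp_sub_right d).mul_const _).integrableOn, integral_Iic_eq_integral_Iio,
    setIntegral_pos_iff_support_of_nonneg_ae]
  · have : Iio p ⊆ (Function.support fun t => f t * f (p - d) - f (t - d) * f p) ∩ Iio p := by
      intro t ht
      refine ⟨ne_of_gt ?_, ht⟩
      simp only [hf, ← Real.exp_add]
      exact sub_pos.2 (Real.exp_lt_exp.2 (aux_sconc ψ h d t p hd ht))
    refine lt_of_lt_of_le ?_ (measure_mono this)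
    simp
  · filter_upwards [ae_restrict_mem measurableSet_Iio] with t ht
    simp only [hf, ← Real.exp_add, Pi.zero_apply]
    exact (sub_pos.2 (Real.exp_lt_exp.2 (aux_sconc ψ h d t p hd ht))).le
  · exact ((hint.mul_const _).sub ((hint.comp_sub_right d).mul_const _)).integrableOn

theorem aux_neg (ψ : ℝ → ℝ) (h : ConcaveOn ℝ univ ψ) : ConcaveOn ℝ univ (fun x => ψ (-x)) := by
  refine ⟨convex_univ, fun x _ y _ a b ha hb hab => ?_⟩
  have := h.2 (mem_univ (-x)) (mem_univ (-y)) ha hb hab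
  convert this using 2
  simp only [smul_eq_mul]; ring

theorem aux_sneg (ψ : ℝ → ℝ) (h : StrictConcaveOn ℝ univ ψ) :
    StrictConcaveOn ℝ univ (fun x => ψ (-x)) := by
  refine ⟨convex_univ, fun x _ y _ hxy a b ha hb hab => ?_⟩
  have := h.2 (mem_univ (-x)) (mem_univ (-y)) (fun h => hxy (neg_injective h)) ha hb hab
  convert this using 2
  simp only [smul_eq_mul]; ring

theorem aux_ratio' (ψ f : ℝ → ℝ) (hf : ∀ x : ℝ, f x = Real.exp (ψ x))
    (h : ConcaveOn ℝ univ ψ) (hint : Integrable f) (y q : ℝ) (hqy : q < y) :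
    (∫ t in Ioi y, f t) * f q ≤ (∫ t in Ioi q, f t) * f y := by
  have := aux_ratio (fun x => ψ (-x)) (fun x => f (-x)) (fun x => hf _) (aux_neg ψ h)
    hint.comp_neg (-y) (-q) (by linarith)
  simpa [integral_comp_neg_Iic] using this

theorem aux_ratio_strict' (ψ f : ℝ → ℝ) (hf : ∀ x : ℝ, f x = Real.exp (ψ x))
    (h : StrictConcaveOn ℝ univ ψ) (hint : Integrable f) (y q : ℝ) (hqy : q < y) :
    (∫ t in Ioi y, f t) * f q < (∫ t in Ioi q, f t) * f y := by
  have := aux_ratio_strict (fun x => ψ (-x)) (fun x => f (-x)) (fun x => hf _) (aux_sneg ψ h)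
    hint.comp_neg (-y) (-q) (by linarith)
  simpa [integral_comp_neg_Iic] using this

theorem aux_wvol (f : ℝ → ℝ) (hf : ∀ x, 0 < f x) (hint : Integrable f) (U : Set ℝ) :
    wvol f U = ENNReal.ofReal (∫ t in U, f t) := by
  rw [wvol, ofReal_integral_eq_lintegral_ofReal hint.integrableOn]
  exact Eventually.of_forall fun x => (hf x).le

theorem aux_F_cont (f : ℝ → ℝ) (hint : Integrable f) : Continuous fun x => ∫ t in Iic x, f t := by
  have : (fun x => ∫ t in Iic x, f t) = fun x => (∫ t in Iic 0, f t) + ∫ t in (0:ℝ)..x, f t := by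
    ext x
    rw [← intervalIntegral.integral_Iic_sub_Iic hint.integrableOn hint.integrableOn]; ring
  rw [this]
  exact continuous_const.add (intervalIntegral.continuous_primitive
    (fun _ _ => hint.intervalIntegrable) 0)

theorem aux_F_strict (f : ℝ → ℝ) (hf : ∀ x, 0 < f x) (hint : Integrable f) {x y : ℝ}
    (hxy : x < y) : ∫ t in Iic x, f t < ∫ t in Iic y, f t := by
  rw [← sub_pos, intervalIntegral.integral_Iic_sub_Iic hint.integrableOn hint.integrableOn]
  exact intervalIntegral.intervalIntegral_pos_of_pos hint.intervalIntegrable hf hxy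

theorem aux_FG (f : ℝ → ℝ) (hint : Integrable f) (x : ℝ) :
    (∫ t in Iic x, f t) + (∫ t in Ioi x, f t) = ∫ t, f t :=
  intervalIntegral.integral_Iic_add_Ioi hint.integrableOn hint.integrableOn

theorem aux_F_surj (f : ℝ → ℝ) (hint : Integrable f) (V : ℝ) (h0 : 0 < V)
    (h1 : V < ∫ t, f t) : ∃ x, ∫ t in Iic x, f t = V := by
  have hT : Tendsto (fun x => ∫ t in Iic x, f t) atTop (nhds (∫ t, f t)) := by
    have := tendsto_setIntegral_of_monotone (μ := volume) (f := f) (s := fun x : ℝ => Iic x)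
      (fun _ => measurableSet_Iic) (fun a b h => Iic_subset_Iic.2 h) hint.integrableOn
    simpa [iUnion_Iic] using this
  have hB : Tendsto (fun x => ∫ t in Iic (-x), f t) atTop (nhds 0) := by
    have := tendsto_setIntegral_of_antitone (μ := volume) (f := f) (s := fun x : ℝ => Iic (-x))
      (fun _ => measurableSet_Iic) (fun a b h => Iic_subset_Iic.2 (neg_le_neg h))
      ⟨0, hint.integrableOn⟩
    have e : (⋂ x : ℝ, Iic (-x)) = ∅ := by
      ext z
      simp only [mem_iInter, mem_Iic, mem_empty_iff_false, iff_false, not_forall, not_le]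
      exact ⟨-z + 1, by linarith⟩
    simpa [e] using this
  obtain ⟨u, hu⟩ := (hB.eventually (gt_mem_nhds h0)).exists
  obtain ⟨v, hv⟩ := (hT.eventually (lt_mem_nhds h1)).exists
  exact mem_range_of_exists_le_of_exists_ge (aux_F_cont f hint) ⟨_, hu.le⟩ ⟨_, hv.le⟩

theorem aux_dich (U s : Set ℝ) (hU : IsOpen U) (hs : IsPreconnected s)
    (h : ∀ z ∈ s, z ∉ frontier U) : s ⊆ U ∨ Disjoint s U := by
  have : s ⊆ U ∨ s ⊆ (closure U)ᶜ := by
    refine hs.subset_or_subset hU isClosed_closure.isOpen_compl ?_ ?_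
    · exact disjoint_left.2 fun z hz hz' => hz' (subset_closure hz)
    · intro z hz
      by_cases hzU : z ∈ closure U
      · left
        by_contra hn
        exact h z hz (by rw [hU.frontier_eq]; exact ⟨hzU, hn⟩)
      · exact Or.inr hzU
  rcases this with h | h
  · exact Or.inl h
  · exact Or.inr (disjoint_left.2 fun z hz hz' => h hz (subset_closure hz'))

theorem aux_mono (f : ℝ → ℝ) (hf : ∀ x, 0 < f x) (hint : Integrable f) {s t : Set ℝ}
    (h : s ⊆ t) : ∫ x in s, f x ≤ ∫ x in t, f x :=
  setIntegral_mono_set hint.integrableOn (Eventually.of_forall fun x => (hf x).le)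
    h.eventuallyLE

/-- the geometric dichotomy -/
theorem aux_geom (f : ℝ → ℝ) (hf : ∀ x, 0 < f x) (hint : Integrable f) (U : Set ℝ)
    (hU : IsOpen U) (w p q : ℝ) (hpq : p ≤ q)
    (hp : ∫ t in Iic p, f t = w) (hq : ∫ t in Ioi q, f t = w)
    (hw : w ≤ ∫ t in U, f t) (hw' : w ≤ (∫ t, f t) - ∫ t in U, f t)
    (hfr : ∀ z ∈ Icc p q, z ∉ frontier U) :
    ∃ x y, x < p ∧ q < y ∧ x ∈ frontier U ∧ y ∈ frontier U ∧
      w ≤ (∫ t in Iic x, f t) + ∫ t in Ioi y, f t := by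
  have hcl : IsClosed (frontier U) := isClosed_frontier
  have FG := aux_FG f hint
  have hdisj : ∀ s : Set ℝ, Disjoint s U → ∫ t in U, f t ≤ ∫ t in sᶜ, f t := fun s hs =>
    aux_mono f hf hint (fun z hz hz' => disjoint_left.1 hs hz' hz)
  have hA : (frontier U ∩ Iic p).Nonempty := by
    by_contra hne
    rw [not_nonempty_iff_eq_empty, eq_empty_iff_forall_notMem] at hne
    obtain ⟨ε, hε, hball⟩ := Metric.isOpen_iff.1 hcl.isOpen_compl q (hfr q ⟨hpq, le_rfl⟩)
    have hd := aux_dich U (Iic (q + ε / 2)) hU isPreconnected_Iic (by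
      intro z hz
      rcases le_or_gt z p with h | h
      · exact fun h' => hne z ⟨h', h⟩
      rcases le_or_gt z q with h2 | h2
      · exact hfr z ⟨h.le, h2⟩
      · refine hball ?_
        rw [Metric.mem_ball, Real.dist_eq, abs_of_pos (by linarith)]
        have : z ≤ q + ε / 2 := hz
        linarith)
    have hs := aux_F_strict f hf hint (show q < q + ε / 2 by linarith)
    have := FG q
    have := FG (q + ε / 2)
    rcases hd with hd | hd
    · have := aux_mono f hf hint hd
      linarith
    · have := hdisj _ hd
      rw [compl_Iic] at this
      linarith
  have hB : (frontier U ∩ Ici q).Nonempty := by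
    by_contra hne
    rw [not_nonempty_iff_eq_empty, eq_empty_iff_forall_notMem] at hne
    obtain ⟨ε, hε, hball⟩ := Metric.isOpen_iff.1 hcl.isOpen_compl p (hfr p ⟨le_rfl, hpq⟩)
    have hd := aux_dich U (Ioi (p - ε / 2)) hU isPreconnected_Ioi (by
      intro z hz
      rcases le_or_gt q z with h | h
      · exact fun h' => hne z ⟨h', h⟩
      rcases le_or_gt p z with h2 | h2
      · exact hfr z ⟨h2, h.le⟩
      · refine hball ?_
        rw [Metric.mem_ball, Real.dist_eq, abs_of_neg (by linarith)]
        have : p - ε / 2 < z := hz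
        linarith)
    have hs := aux_F_strict f hf hint (show p - ε / 2 < p by linarith)
    have := FG p
    have := FG (p - ε / 2)
    rcases hd with hd | hd
    · have := aux_mono f hf hint hd
      linarith
    · have := hdisj _ hd
      rw [compl_Ioi] at this
      linarith
  have bA : BddAbove (frontier U ∩ Iic p) := ⟨p, fun z hz => hz.2⟩
  have bB : BddBelow (frontier U ∩ Ici q) := ⟨q, fun z hz => hz.2⟩
  have hx := (hcl.inter isClosed_Iic).csSup_mem hA bA
  have hy := (hcl.inter isClosed_Ici).csInf_mem hB bB
  have hxu : ∀ z ∈ frontier U ∩ Iic p, z ≤ sSup (frontier U ∩ Iic p) := fun z hz => le_csSup bA hz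
  have hyl : ∀ z ∈ frontier U ∩ Ici q, sInf (frontier U ∩ Ici q) ≤ z := fun z hz => csInf_le bB hz
  generalize sSup (frontier U ∩ Iic p) = x at hx hxu
  generalize sInf (frontier U ∩ Ici q) = y at hy hyl
  have hxp : x < p := lt_of_le_of_ne hx.2 (by rintro rfl; exact hfr x ⟨le_rfl, hpq⟩ hx.1)
  have hqy : q < y := lt_of_le_of_ne hy.2 (by rintro rfl; exact hfr _ ⟨hpq, le_rfl⟩ hy.1)
  refine ⟨x, y, hxp, hqy, hx.1, hy.1, ?_⟩
  have hI : (∫ t in Ioo x y, f t) = (∫ t in Iic y, f t) - ∫ t in Iic x, f t := by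
    rw [intervalIntegral.integral_Iic_sub_Iic hint.integrableOn hint.integrableOn,
      intervalIntegral.integral_of_le (by linarith), integral_Ioc_eq_integral_Ioo]
  have hIc : (∫ t in Ioo x y, f t) + (∫ t in (Ioo x y)ᶜ, f t) = ∫ t, f t :=
    integral_add_compl measurableSet_Ioo hint
  have := FG y
  rcases aux_dich U (Ioo x y) hU isPreconnected_Ioo (by
      intro z hz hzf
      rcases le_or_gt z p with h | h
      · have := hxu z ⟨hzf, h⟩
        linarith [hz.1]
      rcases le_or_gt q z with h2 | h2
      · have := hyl z ⟨hzf, h2⟩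
        linarith [hz.2]
      · exact hfr z ⟨h.le, h2.le⟩ hzf) with hd | hd
  · have := aux_mono f hf hint hd
    linarith
  · have := hdisj _ hd
    linarith

theorem aux_one (f : ℝ → ℝ) (U : Set ℝ) (z : ℝ) (hz : z ∈ frontier U) :
    ENNReal.ofReal (f z) ≤ wper f U :=
  ENNReal.le_tsum (f := fun x : frontier U => ENNReal.ofReal (f x)) ⟨z, hz⟩

theorem aux_two (f : ℝ → ℝ) (hf : ∀ x, 0 < f x) (U : Set ℝ) (x y : ℝ) (hx : x ∈ frontier U)
    (hy : y ∈ frontier U) (hxy : x ≠ y) : ENNReal.ofReal (f x + f y) ≤ wper f U := by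
  have := ENNReal.sum_le_tsum (f := fun x : frontier U => ENNReal.ofReal (f x))
    {⟨x, hx⟩, ⟨y, hy⟩}
  rw [Finset.sum_pair (by simpa using hxy)] at this
  rwa [ENNReal.ofReal_add (hf x).le (hf y).le]

theorem aux_single (f : ℝ → ℝ) (hf : ∀ x, 0 < f x) (hint : Integrable f) (U : Set ℝ)
    (hU : IsOpen U) (z : ℝ) (h0 : 0 < ∫ t in U, f t) (h1 : ∫ t in U, f t < ∫ t, f t)
    (hz : z ∈ frontier U) (h : ∀ y ∈ frontier U, y = z) : U = Iio z ∨ U = Ioi z := by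
  have hzU : z ∉ U := by
    rw [hU.frontier_eq] at hz; exact hz.2
  have d1 := aux_dich U (Iio z) hU isPreconnected_Iio (fun y hy hy' => (ne_of_lt hy) (h y hy'))
  have d2 := aux_dich U (Ioi z) hU isPreconnected_Ioi (fun y hy hy' => (ne_of_gt hy) (h y hy'))
  rcases d1 with d1 | d1 <;> rcases d2 with d2 | d2
  · exfalso
    have h3 : ({z}ᶜ : Set ℝ) ⊆ U := by
      intro t ht
      rcases lt_or_gt_of_ne ht with h | h
      · exact d1 h
      · exact d2 h
    have := aux_mono f hf hint h3
    rw [setIntegral_congr_set (t := univ) (by simp [ae_eq_univ]), setIntegral_univ] at this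
    linarith
  · left
    refine Subset.antisymm (fun t ht => ?_) d1
    rcases lt_trichotomy t z with h | rfl | h
    · exact h
    · exact absurd ht hzU
    · exact absurd ht (disjoint_left.1 d2 h)
  · right
    refine Subset.antisymm (fun t ht => ?_) d2
    rcases lt_trichotomy t z with h | rfl | h
    · exact absurd ht (disjoint_left.1 d1 h)
    · exact absurd ht hzU
    · exact h
  · exfalso
    have : U = ∅ := by
      rw [eq_empty_iff_forall_notMem]
      intro t ht
      rcases lt_trichotomy t z with h | rfl | h
      · exact absurd ht (disjoint_left.1 d1 h)
      · exact absurd ht hzU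
      · exact absurd ht (disjoint_left.1 d2 h)
    simp [this] at h0

theorem aux_core (ψ f : ℝ → ℝ) (hf : ∀ x : ℝ, f x = Real.exp (ψ x))
    (hconc : ConcaveOn ℝ Set.univ ψ) (hint : Integrable f) (w p q : ℝ) (hw0 : 0 < w)
    (hpq : p ≤ q) (hp : ∫ t in Iic p, f t = w) (hq : ∫ t in Ioi q, f t = w)
    (U : Set ℝ) (hU : IsOpen U)
    (hw : w ≤ ∫ t in U, f t) (hw' : w ≤ (∫ t, f t) - ∫ t in U, f t) :
    ENNReal.ofReal (min (f p) (f q)) ≤ wper f U ∧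
    (StrictConcaveOn ℝ Set.univ ψ → wper f U ≤ ENNReal.ofReal (min (f p) (f q)) →
      (∃ x : ℝ, U = Set.Iio x) ∨ (∃ x : ℝ, U = Set.Ioi x)) := by
  have hpos : ∀ x, 0 < f x := fun x => by rw [hf]; exact Real.exp_pos _
  have hm0 : 0 < min (f p) (f q) := lt_min (hpos _) (hpos _)
  by_cases hfr : ∀ z ∈ Icc p q, z ∉ frontier U
  · obtain ⟨x, y, hxp, hqy, hx, hy, hxy⟩ := aux_geom f hpos hint U hU w p q hpq hp hq hw hw' hfr
    have hF : 0 ≤ ∫ t in Iic x, f t := integral_nonneg fun t => (hpos t).le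
    have hG : 0 ≤ ∫ t in Ioi y, f t := integral_nonneg fun t => (hpos t).le
    have hper := aux_two f hpos U x y hx hy (by linarith)
    have k1 := mul_le_mul_of_nonneg_left (min_le_left (f p) (f q)) hF
    have k2 := mul_le_mul_of_nonneg_left (min_le_right (f p) (f q)) hG
    have k3 := mul_le_mul_of_nonneg_right hxy hm0.le
    constructor
    · refine le_trans (ENNReal.ofReal_le_ofReal ?_) hper
      have r1 := aux_ratio ψ f hf hconc hint x p hxp
      have r2 := aux_ratio' ψ f hf hconc hint y q hqy
      rw [hp] at r1
      rw [hq] at r2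
      refine le_of_mul_le_mul_left ?_ hw0
      linarith
    · intro hs hle
      exfalso
      have r1 := aux_ratio_strict ψ f hf hs hint x p hxp
      have r2 := aux_ratio_strict' ψ f hf hs hint y q hqy
      rw [hp] at r1
      rw [hq] at r2
      have h3 := (ENNReal.ofReal_le_ofReal_iff hm0.le).1 (hper.trans hle)
      have := mul_le_mul_of_nonneg_left h3 hw0.le
      linarith
  · push Not at hfr
    obtain ⟨z, hz, hzf⟩ := hfr
    have hmz : min (f p) (f q) ≤ f z := by
      have h1 := hconc.min_le_of_mem_Icc (mem_univ p) (mem_univ q) hz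
      rw [hf p, hf q, hf z]
      rcases min_le_iff.1 h1 with h | h
      · exact (min_le_left _ _).trans (Real.exp_le_exp.2 h)
      · exact (min_le_right _ _).trans (Real.exp_le_exp.2 h)
    refine ⟨(ENNReal.ofReal_le_ofReal hmz).trans (aux_one f U z hzf), fun _ hle => ?_⟩
    have := aux_single f hpos hint U hU z (by linarith) (by linarith) hzf (by
      intro y hy
      by_contra hne
      have h2 := (aux_two f hpos U z y hzf hy (Ne.symm hne)).trans hle
      have h3 := (ENNReal.ofReal_le_ofReal_iff hm0.le).1 h2
      linarith [hpos y])
    exact this.imp (fun h => ⟨z, h⟩) (fun h => ⟨z, h⟩)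

theorem halflines_minimize_logconcave_finite_measure
    (ψ f : ℝ → ℝ) (hf : ∀ x : ℝ, f x = Real.exp (ψ x))
    (hconc : ConcaveOn ℝ Set.univ ψ)
    (hint : Integrable f)
    (V : ℝ) (hV : 0 < V) (hV' : V < ∫ x : ℝ, f x) :
    (∃ Ω : Set ℝ, ((∃ x : ℝ, Ω = Set.Iio x) ∨ (∃ x : ℝ, Ω = Set.Ioi x)) ∧
      IsIsopRegion f Ω (ENNReal.ofReal V)) ∧
    (StrictConcaveOn ℝ Set.univ ψ →
      ∀ Ω : Set ℝ, IsIsopRegion f Ω (ENNReal.ofReal V) →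
        (∃ x : ℝ, Ω = Set.Iio x) ∨ (∃ x : ℝ, Ω = Set.Ioi x)) := by
  have hpos : ∀ x, 0 < f x := fun x => by rw [hf]; exact Real.exp_pos _
  obtain ⟨a, ha⟩ := aux_F_surj f hint V hV hV'
  obtain ⟨b, hb⟩ := aux_F_surj f hint ((∫ x, f x) - V) (by linarith) (by linarith)
  have FGa := aux_FG f hint a
  have FGb := aux_FG f hint b
  have hvol : ∀ U, wvol f U = ENNReal.ofReal V → ∫ t in U, f t = V := by
    intro U h
    rw [aux_wvol f hpos hint] at h
    exact (ENNReal.ofReal_eq_ofReal_iff (integral_nonneg fun t => (hpos t).le) hV.le).1 h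
  have key : ∀ U, IsOpen U → wvol f U = ENNReal.ofReal V →
      ENNReal.ofReal (min (f a) (f b)) ≤ wper f U ∧
      (StrictConcaveOn ℝ Set.univ ψ → wper f U ≤ ENNReal.ofReal (min (f a) (f b)) →
        (∃ x : ℝ, U = Set.Iio x) ∨ (∃ x : ℝ, U = Set.Ioi x)) := by
    intro U hU h
    have hv := hvol U h
    rcases le_total a b with hab | hab
    · have hle : V ≤ (∫ x, f x) - V := by
        rw [← hb]; nth_rw 1 [← ha]
        exact aux_mono f hpos hint (Iic_subset_Iic.2 hab)
      exact aux_core ψ f hf hconc hint V a b hV hab ha (by linarith) U hU (by linarith)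
        (by linarith)
    · have hle : (∫ x, f x) - V ≤ V := by
        rw [← hb]; nth_rw 1 [← ha]
        exact aux_mono f hpos hint (Iic_subset_Iic.2 hab)
      rw [min_comm]
      exact aux_core ψ f hf hconc hint ((∫ x, f x) - V) b a (by linarith) hab hb (by linarith)
        U hU (by linarith) (by linarith)
  have pa : wper f (Iio a) = ENNReal.ofReal (f a) := by
    rw [wper, frontier_Iio]; simp
  have pb : wper f (Ioi b) = ENNReal.ofReal (f b) := by
    rw [wper, frontier_Ioi]; simp
  have va : wvol f (Iio a) = ENNReal.ofReal V := by
    rw [aux_wvol f hpos hint, ← integral_Iic_eq_integral_Iio, ha]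
  have vb : wvol f (Ioi b) = ENNReal.ofReal V := by
    rw [aux_wvol f hpos hint]; congr 1; linarith
  constructor
  · rcases le_total (f a) (f b) with h | h
    · refine ⟨Iio a, Or.inl ⟨a, rfl⟩, isOpen_Iio, va, fun U hU hUV => ?_⟩
      have := (key U hU hUV).1
      rwa [min_eq_left h, ← pa] at this
    · refine ⟨Ioi b, Or.inr ⟨b, rfl⟩, isOpen_Ioi, vb, fun U hU hUV => ?_⟩
      have := (key U hU hUV).1
      rwa [min_eq_right h, ← pb] at this
  · intro hs Ω hΩ
    refine (key Ω hΩ.1 hΩ.2.1).2 hs ?_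
    rcases le_total (f a) (f b) with h | h
    · rw [min_eq_left h, ← pa]
      exact hΩ.2.2 _ isOpen_Iio va
    · rw [min_eq_right h, ← pb]
      exact hΩ.2.2 _ isOpen_Ioi vb
end

section
/- Let f = e^ψ be a continuous positive density on ℝ with ψ convex (f is log-convex). Assume f is not integrable near −∞ nor near +∞, and f(x) → +∞ as x → −∞ and as x → +∞. Then for every V > 0 an isoperimetric region of volume V exists, and every isoperimetric region of volume V is a bounded open interval whose closure contains a point where f attains its global minimum. If moreover ψ is strictly convex, then for each V > 0 the isoperimetric region of volume V is unique. -/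
open Filter MeasureTheory Set

namespace Isop

/-- primitive of the density -/
noncomputable def prim (f : ℝ → ℝ) (x : ℝ) : ℝ := ∫ t in (0:ℝ)..x, f t

/-- right derivative -/
noncomputable def rd (ψ : ℝ → ℝ) (x : ℝ) : ℝ := derivWithin ψ (Ioi x) x

lemma prim_hasDeriv {f : ℝ → ℝ} (hc : Continuous f) (x : ℝ) : HasDerivAt (prim f) (f x) x :=
  intervalIntegral.integral_hasDerivAt_right (hc.intervalIntegrable _ _)
    hc.stronglyMeasurable.stronglyMeasurableAtFilter hc.continuousAt

lemma prim_cont {f : ℝ → ℝ} (hc : Continuous f) : Continuous (prim f) :=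
  continuous_iff_continuousAt.2 fun x => (prim_hasDeriv hc x).continuousAt

lemma prim_strictMono {f : ℝ → ℝ} (hc : Continuous f) (hp : ∀ x, 0 < f x) :
    StrictMono (prim f) :=
  strictMono_of_deriv_pos fun x => by rw [(prim_hasDeriv hc x).deriv]; exact hp x

lemma prim_surj {f : ℝ → ℝ} (hc : Continuous f) (m : ℝ) (hm : 0 < m) (hp : ∀ x, m ≤ f x) :
    Function.Surjective (prim f) := by
  have hmono : Monotone (fun x => prim f x - m * x) := by
    have hd : ∀ x, HasDerivAt (fun x => prim f x - m * x) (f x - m) x := fun x => by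
      have h := (prim_hasDeriv hc x).sub ((hasDerivAt_id x).const_mul m)
      rw [mul_one] at h
      exact h
    refine monotone_of_deriv_nonneg (fun x => (hd x).differentiableAt) fun x => ?_
    rw [(hd x).deriv]; linarith [hp x]
  have h0 : prim f 0 = 0 := by simp [prim]
  refine (prim_cont hc).surjective ?_ ?_
  · refine tendsto_atTop_mono' atTop (f₁ := fun x => m * x) ?_ (tendsto_id.const_mul_atTop hm)
    filter_upwards [eventually_ge_atTop 0] with x hx
    have := hmono hx
    simp only [h0] at this; linarith
  · refine tendsto_atBot_mono' atBot (f₁ := fun x => m * x) (f₂ := prim f) ?_ (tendsto_id.const_mul_atBot hm)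
    filter_upwards [eventually_le_atBot 0] with x hx
    have := hmono hx
    simp only [h0] at this; linarith

lemma rd_hasDeriv {ψ f : ℝ → ℝ} (hf : ∀ x : ℝ, f x = Real.exp (ψ x))
    (hconv : ConvexOn ℝ Set.univ ψ) (x : ℝ) :
    HasDerivWithinAt f (f x * rd ψ x) (Ici x) x := by
  have h := (hconv.hasDerivWithinAt_rightDeriv_of_mem_interior (x := x) (by simp)).Ici_of_Ioi
  have := h.exp
  have e : f = fun x => Real.exp (ψ x) := funext hf
  rw [e]; exact this

lemma rd_mono {ψ : ℝ → ℝ} (hconv : ConvexOn ℝ Set.univ ψ) : Monotone (rd ψ) := by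
  have := hconv.monotoneOn_rightDeriv
  rw [interior_univ] at this
  exact monotoneOn_univ.1 this

lemma rd_strictMono {ψ : ℝ → ℝ} (hconv : StrictConvexOn ℝ Set.univ ψ) : StrictMono (rd ψ) := by
  intro x y hxy
  have h1 := hconv.rightDeriv_lt_slope (x := x) (y := y) (by simp) (by simp) hxy
    (hconv.convexOn.differentiableWithinAt_Ioi_of_mem_interior (by simp))
  have h2 := hconv.convexOn.slope_le_leftDeriv_of_mem_interior (x := x) (y := y) (by simp) (by simp) hxy
  have h3 := hconv.convexOn.leftDeriv_le_rightDeriv_of_mem_interior (x := y) (by simp)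
  exact h1.trans_le (h2.trans h3)

section
variable {ψ f : ℝ → ℝ} (hf : ∀ x : ℝ, f x = Real.exp (ψ x))
    (hconv : ConvexOn ℝ Set.univ ψ) (hc : Continuous f)
include hf hconv hc

lemma key {x y : ℝ} (hxy : x ≤ y) :
    rd ψ x * (prim f y - prim f x) ≤ f y - f x ∧
    f y - f x ≤ rd ψ y * (prim f y - prim f x) := by
  have hp : ∀ x, 0 < f x := fun x => by rw [hf]; positivity
  have hF : ∀ c z, HasDerivWithinAt (fun t => c * (prim f t - prim f x)) (c * f z) (Ici z) z :=
    fun c z => (((prim_hasDeriv hc z).sub_const _).const_mul c).hasDerivWithinAt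
  have hFc : ∀ c, Continuous (fun t => c * (prim f t - prim f x)) := fun c =>
    continuous_const.mul ((prim_cont hc).sub continuous_const)
  have hg : ∀ z, HasDerivWithinAt (fun t => f t - f x) (f z * rd ψ z) (Ici z) z :=
    fun z => (rd_hasDeriv hf hconv z).sub_const _
  have hgc : Continuous (fun t => f t - f x) := hc.sub continuous_const
  constructor
  · refine image_le_of_deriv_right_le_deriv_boundary (hFc _).continuousOn (fun z _ => hF _ z)
      (by simp) hgc.continuousOn (fun z _ => hg z) ?_ (right_mem_Icc.2 hxy)
    intro z hz
    have := rd_mono hconv hz.1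
    nlinarith [hp z]
  · refine image_le_of_deriv_right_le_deriv_boundary hgc.continuousOn (fun z _ => hg z)
      (by simp) (hFc (rd ψ y)).continuousOn (fun z _ => hF _ z) ?_ (right_mem_Icc.2 hxy)
    intro z hz
    have := rd_mono hconv hz.2.le
    nlinarith [hp z]

lemma support (z x : ℝ) : f z + rd ψ z * (prim f x - prim f z) ≤ f x := by
  rcases le_total z x with h | h
  · linarith [(key hf hconv hc h).1]
  · linarith [(key hf hconv hc h).2]

lemma conv_le {x y z s t : ℝ} (hs : 0 ≤ s) (ht : 0 ≤ t) (hst : s + t = 1)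
    (hz : prim f z = s * prim f x + t * prim f y) : f z ≤ s * f x + t * f y := by
  have h1 := mul_le_mul_of_nonneg_left (support hf hconv hc z x) hs
  have h2 := mul_le_mul_of_nonneg_left (support hf hconv hc z y) ht
  have : s * (f z + rd ψ z * (prim f x - prim f z)) + t * (f z + rd ψ z * (prim f y - prim f z))
    = f z := by
    rw [hz]; obtain rfl : s = 1 - t := by linarith
    ring
  linarith

omit hconv in
lemma support_lt (hstr : StrictConvexOn ℝ Set.univ ψ) (z x : ℝ) (hne : x ≠ z) :
    f z + rd ψ z * (prim f x - prim f z) < f x := by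
  have hp : ∀ x, 0 < f x := fun x => by rw [hf]; positivity
  have hm := prim_strictMono hc hp
  rcases lt_or_gt_of_ne hne with h | h
  · obtain ⟨w, h1, h2⟩ := exists_between h
    have a1 := (key hf hstr.convexOn hc h1.le).2
    have a2 := (key hf hstr.convexOn hc h2.le).2
    have := mul_lt_mul_of_pos_right (rd_strictMono hstr h2) (sub_pos.2 (hm h1))
    linarith
  · obtain ⟨w, h1, h2⟩ := exists_between h
    have a1 := (key hf hstr.convexOn hc h1.le).1
    have a2 := (key hf hstr.convexOn hc h2.le).1
    have := mul_lt_mul_of_pos_right (rd_strictMono hstr h1) (sub_pos.2 (hm h2))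
    linarith
end

lemma wvol_Ioo {f : ℝ → ℝ} (hc : Continuous f) (hp : ∀ x, 0 < f x) {a b : ℝ} (hab : a ≤ b) :
    wvol f (Ioo a b) = ENNReal.ofReal (prim f b - prim f a) := by
  have h : prim f b - prim f a = ∫ t in Ioo a b, f t := by
    rw [prim, prim, intervalIntegral.integral_interval_sub_left (hc.intervalIntegrable _ _)
      (hc.intervalIntegrable _ _), intervalIntegral.integral_of_le hab, integral_Ioc_eq_integral_Ioo]
  rw [h, wvol, ofReal_integral_eq_lintegral_ofReal]
  · exact (hc.integrableOn_Icc).mono_set Ioo_subset_Icc_self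
  · exact Eventually.of_forall fun x => (hp x).le

lemma wvol_mono (f : ℝ → ℝ) {A B : Set ℝ} (h : A ⊆ B) : wvol f A ≤ wvol f B :=
  lintegral_mono_set h

lemma wper_ge (f : ℝ → ℝ) (U : Set ℝ) (s : Finset ℝ) (h : (s : Set ℝ) ⊆ frontier U) :
    ∑ x ∈ s, ENNReal.ofReal (f x) ≤ wper f U := by
  rw [← Finset.tsum_subtype' s (fun x => ENNReal.ofReal (f x))]
  exact ENNReal.tsum_mono_subtype (fun x => ENNReal.ofReal (f x)) h

lemma wper_Ioo {f : ℝ → ℝ} (hp : ∀ x, 0 < f x) {a b : ℝ} (hab : a < b) :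
    wper f (Ioo a b) = ENNReal.ofReal (f a + f b) := by
  have : frontier (Ioo a b) = (({a, b} : Finset ℝ) : Set ℝ) := by
    rw [frontier_Ioo hab]; simp
  rw [wper, this, Finset.tsum_subtype' {a, b} (fun x => ENNReal.ofReal (f x)),
    Finset.sum_pair hab.ne, ENNReal.ofReal_add (hp a).le (hp b).le]

lemma exists_frontier {A U : Set ℝ} (hA : IsPreconnected A) (h1 : (A ∩ U).Nonempty)
    (h2 : ¬ A ⊆ U) (hU : IsOpen U) : ∃ x ∈ A, x ∈ frontier U := by
  by_contra hcon
  push Not at hcon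
  apply h2
  refine hA.subset_of_closure_inter_subset hU h1 ?_
  rintro x ⟨hx, hxA⟩
  by_contra hxU
  exact hcon x hxA ⟨hx, by rwa [hU.interior_eq]⟩

lemma bdd_above {f : ℝ → ℝ} (hc : Continuous f) (hp : ∀ x, 0 < f x)
    (hs : Function.Surjective (prim f)) (hlim : Tendsto f atTop atTop)
    {U : Set ℝ} (hU : IsOpen U) (hv : wvol f U < ⊤) (hper : wper f U < ⊤) : BddAbove U := by
  by_contra hb
  have hm := prim_strictMono hc hp
  obtain ⟨M, hM⟩ := (hlim.eventually (eventually_gt_atTop (wper f U).toReal)).exists_forall_of_atTop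
  rw [not_bddAbove_iff] at hb
  obtain ⟨u, huU, hu⟩ := hb M
  have hns : ¬ Ici u ⊆ U := by
    intro hsub
    obtain ⟨x, hx⟩ := hs (prim f u + (wvol f U).toReal + 1)
    have hux : u < x := hm.lt_iff_lt.1 (by rw [hx]; linarith [ENNReal.toReal_nonneg (a := wvol f U)])
    have := (wvol_mono f ((Ioo_subset_Ioi_self.trans Ioi_subset_Ici_self).trans hsub : Ioo u x ⊆ U))
    rw [wvol_Ioo hc hp hux.le, ENNReal.ofReal_le_iff_le_toReal hv.ne, hx] at this
    linarith
  obtain ⟨x, hx, hxf⟩ := exists_frontier isPreconnected_Ici ⟨u, self_mem_Ici, huU⟩ hns hU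
  have h := wper_ge f U {x} (by simpa using hxf)
  rw [Finset.sum_singleton, ENNReal.ofReal_le_iff_le_toReal hper.ne] at h
  exact absurd h (not_le.2 (hM x (hu.le.trans hx)))

lemma bdd_below {f : ℝ → ℝ} (hc : Continuous f) (hp : ∀ x, 0 < f x)
    (hs : Function.Surjective (prim f)) (hlim : Tendsto f atBot atTop)
    {U : Set ℝ} (hU : IsOpen U) (hv : wvol f U < ⊤) (hper : wper f U < ⊤) : BddBelow U := by
  by_contra hb
  have hm := prim_strictMono hc hp
  obtain ⟨M, hM⟩ := (hlim.eventually (eventually_gt_atTop (wper f U).toReal)).exists_forall_of_atBot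
  rw [not_bddBelow_iff] at hb
  obtain ⟨u, huU, hu⟩ := hb M
  have hns : ¬ Iic u ⊆ U := by
    intro hsub
    obtain ⟨x, hx⟩ := hs (prim f u - (wvol f U).toReal - 1)
    have hux : x < u := hm.lt_iff_lt.1 (by rw [hx]; linarith [ENNReal.toReal_nonneg (a := wvol f U)])
    have := (wvol_mono f ((Ioo_subset_Iio_self.trans Iio_subset_Iic_self).trans hsub : Ioo x u ⊆ U))
    rw [wvol_Ioo hc hp hux.le, ENNReal.ofReal_le_iff_le_toReal hv.ne, hx] at this
    linarith
  obtain ⟨x, hx, hxf⟩ := exists_frontier isPreconnected_Iic ⟨u, self_mem_Iic, huU⟩ hns hU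
  have h := wper_ge f U {x} (by simpa using hxf)
  rw [Finset.sum_singleton, ENNReal.ofReal_le_iff_le_toReal hper.ne] at h
  exact absurd h (not_le.2 (hM x (le_trans hx hu.le)))

/-- An open set of finite perimeter and volume `V > 0` is an interval or strictly beaten by its hull. -/
lemma hull {f : ℝ → ℝ} (hc : Continuous f) (hp : ∀ x, 0 < f x)
    (hs : Function.Surjective (prim f)) (hlim₁ : Tendsto f atBot atTop)
    (hlim₂ : Tendsto f atTop atTop) {V : ℝ} (hV : 0 < V)
    {U : Set ℝ} (hU : IsOpen U) (hv : wvol f U = ENNReal.ofReal V) (hper : wper f U < ⊤) :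
    ∃ a b, a < b ∧ V ≤ prim f b - prim f a ∧ ENNReal.ofReal (f a + f b) ≤ wper f U ∧
      (U = Ioo a b ∨ ENNReal.ofReal (f a + f b) < wper f U) := by
  have hvt : wvol f U < ⊤ := hv ▸ ENNReal.ofReal_lt_top
  have hA := bdd_above hc hp hs hlim₂ hU hvt hper
  have hB := bdd_below hc hp hs hlim₁ hU hvt hper
  have hne : U.Nonempty := by
    rw [nonempty_iff_ne_empty]; rintro rfl
    simp [wvol] at hv; linarith
  have hsub : U ⊆ Ioo (sInf U) (sSup U) := by
    intro x hx
    obtain ⟨l, u, hlu, hsub⟩ := mem_nhds_iff_exists_Ioo_subset.1 (hU.mem_nhds hx)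
    obtain ⟨p, hp1, hp2⟩ := exists_between hlu.1
    obtain ⟨q, hq1, hq2⟩ := exists_between hlu.2
    exact ⟨(csInf_le hB (hsub ⟨hp1, hp2.trans hlu.2⟩)).trans_lt hp2,
      hq1.trans_le (le_csSup hA (hsub ⟨hlu.1.trans hq1, hq2⟩))⟩
  obtain ⟨x0, hx0⟩ := hne
  have hab : sInf U < sSup U := (hsub hx0).1.trans (hsub hx0).2
  have ha : sInf U ∈ frontier U := ⟨csInf_mem_closure ⟨x0, hx0⟩ hB, by
    rw [hU.interior_eq]; exact fun h => lt_irrefl _ (hsub h).1⟩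
  have hb : sSup U ∈ frontier U := ⟨csSup_mem_closure ⟨x0, hx0⟩ hA, by
    rw [hU.interior_eq]; exact fun h => lt_irrefl _ (hsub h).2⟩
  have hm := prim_strictMono hc hp
  refine ⟨sInf U, sSup U, hab, ?_, ?_, ?_⟩
  · have := wvol_mono f hsub
    rw [hv, wvol_Ioo hc hp hab.le] at this
    exact (ENNReal.ofReal_le_ofReal_iff (sub_nonneg.2 (hm hab).le)).1 this
  · have := wper_ge f U {sInf U, sSup U} (by
      intro x; simp only [Finset.coe_insert, Finset.coe_singleton, mem_insert_iff, mem_singleton_iff]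
      rintro (rfl | rfl) <;> assumption)
    rwa [Finset.sum_pair hab.ne, ← ENNReal.ofReal_add (hp _).le (hp _).le] at this
  · by_cases h : Ioo (sInf U) (sSup U) ⊆ U
    · exact Or.inl (hsub.antisymm h)
    · right
      obtain ⟨c, hcI, hcf⟩ := exists_frontier isPreconnected_Ioo ⟨x0, hsub hx0, hx0⟩ h hU
      have := wper_ge f U {c, sInf U, sSup U} (by
        intro x; simp only [Finset.coe_insert, Finset.coe_singleton, mem_insert_iff, mem_singleton_iff]
        rintro (rfl | rfl | rfl) <;> assumption)
      rw [Finset.sum_insert (by simp [hcI.1.ne', hcI.2.ne]), Finset.sum_pair hab.ne,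
        ← ENNReal.ofReal_add (hp _).le (hp _).le,
        ← ENNReal.ofReal_add (hp _).le (add_pos (hp _) (hp _)).le] at this
      refine lt_of_lt_of_le ?_ this
      rw [ENNReal.ofReal_lt_ofReal_iff (add_pos (hp _) (add_pos (hp _) (hp _)))]
      linarith [hp c]

section
variable {ψ f : ℝ → ℝ} (hf : ∀ x : ℝ, f x = Real.exp (ψ x))
    (hconv : ConvexOn ℝ Set.univ ψ) (hc : Continuous f)
    (hs : Function.Surjective (prim f))
include hf hconv hc hs

lemma shrink {V : ℝ} (hV : 0 < V) {a b : ℝ} (h : V ≤ prim f b - prim f a) :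
    ∃ a' b', prim f b' - prim f a' = V ∧ f a' + f b' ≤ f a + f b := by
  set L := prim f b - prim f a with hL
  have hLp : 0 < L := hV.trans_le h
  have hr : V / L ≤ 1 := (div_le_one hLp).2 h
  have hr0 : 0 ≤ V / L := by positivity
  have hrL : V / L * L = V := by field_simp
  set r := V / L
  obtain ⟨a', ha'⟩ := hs ((1 + r) / 2 * prim f a + (1 - r) / 2 * prim f b)
  obtain ⟨b', hb'⟩ := hs ((1 - r) / 2 * prim f a + (1 + r) / 2 * prim f b)
  refine ⟨a', b', ?_, ?_⟩
  · rw [ha', hb', ← hrL, hL]; ring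
  · have h1 := conv_le hf hconv hc (by linarith) (by linarith) (by ring) ha'
    have h2 := conv_le hf hconv hc (by linarith) (by linarith) (by ring) hb'
    linarith

lemma exists_min {V : ℝ} (hV : 0 < V) (hlim₁ : Tendsto f atBot atTop)
    (hlim₂ : Tendsto f atTop atTop) :
    ∃ a b, prim f b - prim f a = V ∧
      ∀ a' b', prim f b' - prim f a' = V → f a + f b ≤ f a' + f b' := by
  have hp : ∀ x, 0 < f x := fun x => by rw [hf]; positivity
  have hm := prim_strictMono hc hp
  let e := (StrictMono.orderIsoOfSurjective (prim f) hm hs).toHomeomorph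
  have he : ∀ x, e x = prim f x := fun x => rfl
  have hφ : Continuous fun a => f a + f (e.symm (e a + V)) := by fun_prop
  have ht : Tendsto (fun a => f a + f (e.symm (e a + V))) (cocompact ℝ) atTop := by
    refine tendsto_atTop_mono (f := f) (fun a => by linarith [hp (e.symm (e a + V))]) ?_
    rw [cocompact_eq_atBot_atTop]
    exact hlim₁.sup hlim₂
  obtain ⟨a, ha⟩ := hφ.exists_forall_le ht
  refine ⟨a, e.symm (e a + V), ?_, fun a' b' h => ?_⟩
  · rw [← he, ← he, e.apply_symm_apply]; ring
  · have : b' = e.symm (e a' + V) := by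
      rw [Homeomorph.eq_symm_apply]
      rw [he, he]; linarith
    rw [this]; exact ha a'
end

end Isop

/-- For a log-convex density `f = e^ψ` on `ℝ` whose both ends have
infinite measure and with `f → +∞` at both ends, isoperimetric regions of any volume
`V > 0` exist and are bounded open intervals in whose closure `f` attains its global
minimum; if `ψ` is strictly convex, the minimizer of each volume is unique. -/
theorem minimizers_logconvex_both_ends_infinite
    (ψ f : ℝ → ℝ) (hf : ∀ x : ℝ, f x = Real.exp (ψ x))
    (hconv : ConvexOn ℝ Set.univ ψ)
    (h₁ : ¬ IntegrableOn f (Set.Iic 0))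
    (h₂ : ¬ IntegrableOn f (Set.Ici 0))
    (hlim₁ : Tendsto f atBot atTop) (hlim₂ : Tendsto f atTop atTop)
    (V : ℝ) (hV : 0 < V) :
    ((∃ Ω : Set ℝ, IsIsopRegion f Ω (ENNReal.ofReal V)) ∧
      (∀ Ω : Set ℝ, IsIsopRegion f Ω (ENNReal.ofReal V) →
        ∃ a b : ℝ, a < b ∧ Ω = Set.Ioo a b ∧
          ∃ c ∈ Set.Icc a b, ∀ y : ℝ, f c ≤ f y)) ∧
    (StrictConvexOn ℝ Set.univ ψ →
      ∀ Ω₁ Ω₂ : Set ℝ, IsIsopRegion f Ω₁ (ENNReal.ofReal V) →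
        IsIsopRegion f Ω₂ (ENNReal.ofReal V) → Ω₁ = Ω₂) := by
  have hp : ∀ x, 0 < f x := fun x => by rw [hf]; positivity
  have hc : Continuous f := by
    have h : Continuous ψ := continuousOn_univ.1 (hconv.continuousOn isOpen_univ)
    rw [show f = fun x => Real.exp (ψ x) from funext hf]
    exact Real.continuous_exp.comp h
  obtain ⟨m, hmin⟩ := hc.exists_forall_le (by
    rw [cocompact_eq_atBot_atTop]
    exact hlim₁.sup hlim₂)
  have hs := Isop.prim_surj hc (f m) (hp m) hmin
  have hmono := Isop.prim_strictMono hc hp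
  have hlt : ∀ {a b : ℝ}, Isop.prim f b - Isop.prim f a = V → a < b := fun h =>
    hmono.lt_iff_lt.1 (by linarith)
  have hvolI : ∀ {a b : ℝ}, Isop.prim f b - Isop.prim f a = V →
      wvol f (Ioo a b) = ENNReal.ofReal V := fun h => by
    rw [Isop.wvol_Ioo hc hp (hlt h).le, h]
  -- every minimizer is an interval which is optimal among intervals
  have hint : ∀ Ω : Set ℝ, IsIsopRegion f Ω (ENNReal.ofReal V) →
      ∃ a b : ℝ, Isop.prim f b - Isop.prim f a = V ∧ Ω = Ioo a b ∧
        ∀ a' b', Isop.prim f b' - Isop.prim f a' = V → f a + f b ≤ f a' + f b' := by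
    rintro Ω ⟨hO, hv, hopt⟩
    have hle : ∀ a' b', Isop.prim f b' - Isop.prim f a' = V →
        wper f Ω ≤ ENNReal.ofReal (f a' + f b') := fun a' b' h => by
      rw [← Isop.wper_Ioo hp (hlt h)]; exact hopt _ isOpen_Ioo (hvolI h)
    obtain ⟨a0, b0, h0, -⟩ := Isop.exists_min hf hconv hc hs hV hlim₁ hlim₂
    have hfin : wper f Ω < ⊤ := (hle a0 b0 h0).trans_lt ENNReal.ofReal_lt_top
    obtain ⟨a, b, hab, hVab, -, h⟩ := Isop.hull hc hp hs hlim₁ hlim₂ hV hO hv hfin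
    rcases h with rfl | h
    · refine ⟨a, b, ?_, rfl, ?_⟩
      · rw [Isop.wvol_Ioo hc hp hab.le] at hv
        exact (ENNReal.ofReal_eq_ofReal_iff (hV.le.trans hVab) hV.le).1 hv
      · intro a' b' h'
        have := hle a' b' h'
        rw [Isop.wper_Ioo hp hab] at this
        exact (ENNReal.ofReal_le_ofReal_iff (add_pos (hp _) (hp _)).le).1 this
    · obtain ⟨a', b', h1, h2⟩ := Isop.shrink hf hconv hc hs hV hVab
      exact absurd ((hle a' b' h1).trans (ENNReal.ofReal_le_ofReal h2)) (not_le.2 h)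
  refine ⟨⟨?_, ?_⟩, ?_⟩
  · obtain ⟨a, b, h0, hopt⟩ := Isop.exists_min hf hconv hc hs hV hlim₁ hlim₂
    refine ⟨Ioo a b, isOpen_Ioo, hvolI h0, fun U hU hv => ?_⟩
    rcases eq_or_ne (wper f U) ⊤ with h | h
    · rw [h]; exact le_top
    obtain ⟨a', b', -, h1, h2, -⟩ := Isop.hull hc hp hs hlim₁ hlim₂ hV hU hv (lt_top_iff_ne_top.2 h)
    obtain ⟨a'', b'', h3, h4⟩ := Isop.shrink hf hconv hc hs hV h1
    rw [Isop.wper_Ioo hp (hlt h0)]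
    exact (ENNReal.ofReal_le_ofReal ((hopt _ _ h3).trans h4)).trans h2
  · intro Ω hΩ
    obtain ⟨a, b, h0, rfl, hopt⟩ := hint Ω hΩ
    have hab := hlt h0
    refine ⟨a, b, hab, rfl, ?_⟩
    -- `f` lies below its value at the far end, between that end and `m`
    have hbetween : ∀ x z : ℝ, (Isop.prim f x ≤ Isop.prim f z ∧ Isop.prim f z ≤ Isop.prim f m) ∨
        (Isop.prim f m ≤ Isop.prim f z ∧ Isop.prim f z ≤ Isop.prim f x) → f z ≤ f x := by
      intro x z hz
      by_contra hcon
      push Not at hcon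
      have e1 := Isop.support hf hconv hc z x
      have e2 := Isop.support hf hconv hc z m
      have e3 := hmin x
      rcases hz with hz | hz
      · rcases le_total 0 (Isop.rd ψ z) with hr | hr
        · nlinarith
        · nlinarith
      · rcases le_total 0 (Isop.rd ψ z) with hr | hr
        · nlinarith
        · nlinarith
    by_cases hm : m ∈ Icc a b
    · exact ⟨m, hm, hmin⟩
    rw [mem_Icc, not_and_or, not_le, not_le] at hm
    rcases hm with hm | hm
    · refine ⟨a, left_mem_Icc.2 hab.le, fun y => le_trans ?_ (hmin y)⟩
      obtain ⟨b', hb'⟩ := hs (Isop.prim f m + V)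
      have h1 := hopt m b' (by linarith)
      have h2 := hbetween b b' (Or.inr ⟨by linarith, by linarith [hmono hm]⟩)
      linarith
    · refine ⟨b, right_mem_Icc.2 hab.le, fun y => le_trans ?_ (hmin y)⟩
      obtain ⟨a', ha'⟩ := hs (Isop.prim f m - V)
      have h1 := hopt a' m (by linarith)
      have h2 := hbetween a a' (Or.inl ⟨by linarith [hmono hm], by linarith⟩)
      linarith
  · intro hstr Ω₁ Ω₂ hΩ₁ hΩ₂
    obtain ⟨a1, b1, h1, rfl, o1⟩ := hint Ω₁ hΩ₁
    obtain ⟨a2, b2, h2, rfl, o2⟩ := hint Ω₂ hΩ₂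
    by_cases ha : a1 = a2
    · subst ha
      have : b1 = b2 := hmono.injective (by linarith)
      rw [this]
    · exfalso
      obtain ⟨a3, ha3⟩ := hs ((1 / 2) * Isop.prim f a1 + (1 / 2) * Isop.prim f a2)
      obtain ⟨b3, hb3⟩ := hs ((1 / 2) * Isop.prim f b1 + (1 / 2) * Isop.prim f b2)
      have hne : Isop.prim f a1 ≠ Isop.prim f a2 := fun h => ha (hmono.injective h)
      have n1 : a1 ≠ a3 := by rintro rfl; exact hne (by linarith)
      have n2 : a2 ≠ a3 := by rintro rfl; exact hne (by linarith)
      have s1 := Isop.support_lt hf hc hstr a3 a1 n1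
      have s2 := Isop.support_lt hf hc hstr a3 a2 n2
      have s3 := Isop.conv_le hf hconv hc (by norm_num) (by norm_num) (by norm_num) hb3
      have e : Isop.rd ψ a3 * (Isop.prim f a1 - Isop.prim f a3) +
          Isop.rd ψ a3 * (Isop.prim f a2 - Isop.prim f a3) = 0 := by rw [ha3]; ring
      have q1 := o1 a3 b3 (by linarith)
      have q2 := o2 a3 b3 (by linarith)
      linarith
end
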